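/- Let n ≥ 0 and suppose U^n = G_1⋯G_r where each G_i is a conjugate of U in SL(2,ℤ). Then there exists an integer s ≥ 0 with r = n + 12s, and a finite sequence of Hurwitz moves transforms the sequence (G_1,…,G_r) into the sequence consisting of n copies of U followed by 6s copies of the pair (V, U), i.e. into the factorization U^n(VU)^{6s}. -/

import Mathlib

/-- `SL(2,ℤ)`, the group of 2×2 integer matrices of determinant 1. -/
abbrev SL2Z := Matrix.SpecialLinearGroup (Fin 2) ℤ

/-- The matrix `U = [[1,1],[0,1]]`. -/
def U : SL2Z := ⟨!![1, 1; 0, 1], by norm_num [Matrix.det_fin_two_of]⟩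

/-- The matrix `V = [[1,0],[-1,1]]`. -/
def V : SL2Z := ⟨!![1, 0; -1, 1], by norm_num [Matrix.det_fin_two_of]⟩

/-- A single Hurwitz move on a finite sequence of elements of a group: some consecutive
pair `(a, b)` is replaced by `(b, b⁻¹ * a * b)` or by `(a * b * a⁻¹, a)`. -/
def HurwitzMove {G : Type*} [Group G] (L L' : List G) : Prop :=
  ∃ (p : List G) (a b : G) (t : List G),
    L = p ++ a :: b :: t ∧
    (L' = p ++ b :: (b⁻¹ * a * b) :: t ∨ L' = p ++ (a * b * a⁻¹) :: a :: t)

/-- A finite sequence of Hurwitz moves. -/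
def HurwitzEquiv {G : Type*} [Group G] : List G → List G → Prop :=
  Relation.ReflTransGen HurwitzMove

namespace HurwitzSL2

/-! ### The rotations and signs -/

/-- The rotation by a quarter turn. -/
def J : SL2Z := ⟨!![0, -1; 1, 0], by norm_num [Matrix.det_fin_two_of]⟩

/-- An element of order six; it cyclically permutes (up to sign) the vectors
`(1,0)`, `(0,1)`, `(-1,1)`. -/
def δ : SL2Z := ⟨!![0, -1; 1, 1], by norm_num [Matrix.det_fin_two_of]⟩

/-- The transvection along the vector `(1,1)`. -/
def W : SL2Z := V⁻¹ * U * V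

/-- Equality up to sign. -/
def SignEq (a b : SL2Z) : Prop := a = b ∨ a = -b

theorem SignEq.mul_left {a b : SL2Z} (h : SignEq a b) (c : SL2Z) : SignEq (c * a) (c * b) := by
  rcases h with rfl | rfl
  · exact Or.inl rfl
  · exact Or.inr (mul_neg _ _)

theorem SignEq.mul_right {a b : SL2Z} (h : SignEq a b) (c : SL2Z) : SignEq (a * c) (b * c) := by
  rcases h with rfl | rfl
  · exact Or.inl rfl
  · exact Or.inr (neg_mul _ _)

theorem SignEq.symm {a b : SL2Z} (h : SignEq a b) : SignEq b a := by
  rcases h with rfl | rfl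
  · exact Or.inl rfl
  · exact Or.inr (neg_neg _).symm

theorem SignEq.trans {a b c : SL2Z} (h : SignEq a b) (h' : SignEq b c) : SignEq a c := by
  rcases h with rfl | rfl <;> rcases h' with rfl | rfl
  · exact Or.inl rfl
  · exact Or.inr rfl
  · exact Or.inr rfl
  · exact Or.inl (neg_neg _)

theorem SignEq.conj_eq {a b : SL2Z} (h : SignEq a b) (g : SL2Z) : a * g * a⁻¹ = b * g * b⁻¹ := by
  rcases h with rfl | rfl
  · rfl
  · simp

/-! ### Nonnegative matrices -/

/-- All entries have the same sign, in the weak sense. -/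
def SameSign (K : SL2Z) : Prop := (∀ i j, 0 ≤ K i j) ∨ (∀ i j, K i j ≤ 0)

theorem sameSign_iff (K : SL2Z) : SameSign K ↔
    (0 ≤ K 0 0 ∧ 0 ≤ K 0 1 ∧ 0 ≤ K 1 0 ∧ 0 ≤ K 1 1) ∨
    (K 0 0 ≤ 0 ∧ K 0 1 ≤ 0 ∧ K 1 0 ≤ 0 ∧ K 1 1 ≤ 0) := by
  simp [SameSign, Fin.forall_fin_two, and_assoc]

theorem det_entries (K : SL2Z) : K 0 0 * K 1 1 - K 0 1 * K 1 0 = 1 := by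
  have := K.det_coe
  rwa [Matrix.det_fin_two] at this

theorem mul_entry (K L : SL2Z) (i j : Fin 2) :
    (K * L) i j = K i 0 * L 0 j + K i 1 * L 1 j := by
  have h : ((K * L : SL2Z) : Matrix (Fin 2) (Fin 2) ℤ) = K.1 * L.1 := rfl
  rw [h, Matrix.mul_apply, Fin.sum_univ_two]

theorem SameSign.neg {K : SL2Z} (h : SameSign K) : SameSign (-K) := by
  have e : ∀ i j, (-K) i j = -K i j := fun _ _ => rfl
  rw [sameSign_iff] at *
  simp only [e]
  omega

theorem SameSign.mul {K L : SL2Z} (hK : SameSign K) (hL : SameSign L) : SameSign (K * L) := by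
  rcases hK with hK | hK <;> rcases hL with hL | hL
  · left; intro i j; rw [mul_entry]
    exact add_nonneg (mul_nonneg (hK _ _) (hL _ _)) (mul_nonneg (hK _ _) (hL _ _))
  · right; intro i j; rw [mul_entry]
    exact add_nonpos (mul_nonpos_of_nonneg_of_nonpos (hK _ _) (hL _ _))
      (mul_nonpos_of_nonneg_of_nonpos (hK _ _) (hL _ _))
  · right; intro i j; rw [mul_entry]
    exact add_nonpos (mul_nonpos_of_nonpos_of_nonneg (hK _ _) (hL _ _))
      (mul_nonpos_of_nonpos_of_nonneg (hK _ _) (hL _ _))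
  · left; intro i j; rw [mul_entry]
    exact add_nonneg (mul_nonneg_of_nonpos_of_nonpos (hK _ _) (hL _ _))
      (mul_nonneg_of_nonpos_of_nonpos (hK _ _) (hL _ _))

theorem sameSign_one : SameSign 1 := by rw [sameSign_iff]; decide
theorem sameSign_U : SameSign U := by rw [sameSign_iff]; decide
theorem sameSign_V_inv : SameSign V⁻¹ := by rw [sameSign_iff]; decide

/-- Conjugating the inverse by the quarter turn gives the transpose. -/
theorem SameSign.transpose {K : SL2Z} (h : SameSign K) : SameSign (J⁻¹ * K⁻¹ * J) := by
  have e : ∀ i j, (J⁻¹ * K⁻¹ * J) i j = K j i := by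
    have h00 : K⁻¹ 0 0 = K 1 1 := by simp [Matrix.SpecialLinearGroup.SL2_inv_expl]
    have h01 : K⁻¹ 0 1 = -K 0 1 := by simp [Matrix.SpecialLinearGroup.SL2_inv_expl]
    have h10 : K⁻¹ 1 0 = -K 1 0 := by simp [Matrix.SpecialLinearGroup.SL2_inv_expl]
    have h11 : K⁻¹ 1 1 = K 0 0 := by simp [Matrix.SpecialLinearGroup.SL2_inv_expl]
    have hJ : J⁻¹ = -J := by decide
    have j00 : J 0 0 = 0 := rfl
    have j01 : J 0 1 = -1 := rfl
    have j10 : J 1 0 = 1 := rfl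
    have j11 : J 1 1 = 0 := rfl
    have n : ∀ i j, (-J) i j = -J i j := fun _ _ => rfl
    simp only [Fin.forall_fin_two, hJ, mul_entry, n, h00, h01, h10, h11, j00, j01, j10, j11]
    omega
  exact h.imp (fun h i j => (e i j).symm ▸ h j i) (fun h i j => (e i j).symm ▸ h j i)

theorem SameSign.mul_lowerLeft_ne_zero {K L : SL2Z} (hK : SameSign K) (hL : SameSign L)
    (h : K 1 0 ≠ 0 ∨ L 1 0 ≠ 0) : (K * L) 1 0 ≠ 0 := by
  have dK := det_entries K
  have dL := det_entries L
  rw [sameSign_iff] at hK hL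
  rw [mul_entry]
  have hK1 : K 1 1 ≠ 0 := by
    intro h0
    rw [h0] at dK
    rcases hK with hK | hK <;> nlinarith
  have hL0 : L 0 0 ≠ 0 := by
    intro h0
    rw [h0] at dL
    rcases hL with hL | hL <;> nlinarith
  generalize K 1 0 = a at *
  generalize K 1 1 = b at *
  generalize L 0 0 = c at *
  generalize L 1 0 = d at *
  intro h0
  have hac : a * c = 0 ∧ b * d = 0 := by
    rcases hK with ⟨_, _, ha, hb⟩ | ⟨_, _, ha, hb⟩ <;>
      rcases hL with ⟨hc, _, hd, _⟩ | ⟨hc, _, hd, _⟩ <;> constructor <;> nlinarith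
  rcases h with h | h
  · exact (mul_ne_zero h hL0) hac.1
  · exact (mul_ne_zero hK1 h) hac.2

/-! ### Oriented edges of the Farey tree -/

/-- The element of `SL(2,ℤ)` attached to a turn. -/
def letter : Bool → SL2Z
  | false => U
  | true => V⁻¹

/-- The element of `SL(2,ℤ)` attached to a sequence of turns. -/
def word (z : List Bool) : SL2Z := (z.map letter).prod

@[simp] theorem word_nil : word [] = 1 := rfl
@[simp] theorem word_cons (b : Bool) (z : List Bool) : word (b :: z) = letter b * word z := by
  simp [word]
@[simp] theorem word_append (y z : List Bool) : word (y ++ z) = word y * word z := by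
  simp [word]

theorem sameSign_word (z : List Bool) : SameSign (word z) := by
  induction z with
  | nil => exact sameSign_one
  | cons b z ih =>
    rw [word_cons]
    refine SameSign.mul ?_ ih
    cases b
    · exact sameSign_U
    · exact sameSign_V_inv

/-- An edge of the Farey tree pointing away from the base vertex: a sector at the base vertex
followed by a sequence of turns. -/
abbrev Edge := Fin 3 × List Bool

/-- The matrix whose columns span the cone behind an edge. -/
def edge (e : Edge) : SL2Z := δ ^ (e.1 : ℕ) * word e.2

/-- The edge `e` lies on the path leading to `f`. -/
def Edge.Le (e f : Edge) : Prop := e.1 = f.1 ∧ e.2 <+: f.2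

/-- The cone of `B` is contained in the complement of the cone of `A`. -/
def Apart (A B : SL2Z) : Prop := ∃ K, SameSign K ∧ B = A * J * K

theorem apart_iff {A B : SL2Z} : Apart A B ↔ SameSign (J⁻¹ * A⁻¹ * B) := by
  constructor
  · rintro ⟨K, hK, rfl⟩
    simpa [mul_assoc] using hK
  · intro h
    exact ⟨_, h, by group⟩

theorem Apart.symm {A B : SL2Z} (h : Apart A B) : Apart B A := by
  obtain ⟨K, hK, rfl⟩ := h
  rw [apart_iff]
  have e : J⁻¹ * (A * J * K)⁻¹ * A = -(J⁻¹ * K⁻¹ * J) := by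
    have : J⁻¹ = -J := by decide
    simp [mul_assoc, this]
  rw [e]
  exact hK.transpose.neg

theorem apart_word {z w : List Bool} (h : ¬ z <+: w) (h' : ¬ w <+: z) :
    Apart (word z) (word w) := by
  induction z generalizing w with
  | nil => exact absurd List.nil_prefix h
  | cons a z ih =>
    cases w with
    | nil => exact absurd List.nil_prefix h'
    | cons b w =>
      by_cases hab : a = b
      · subst hab
        simp only [List.cons_prefix_cons, true_and] at h h'
        obtain ⟨K, hK, e⟩ := ih h h'
        exact ⟨K, hK, by simp [e, mul_assoc]⟩
      · rw [apart_iff]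
        have e : J⁻¹ * (word (a :: z))⁻¹ * word (b :: w) =
            (J⁻¹ * (word z)⁻¹ * J) * ((J⁻¹ * (letter a)⁻¹ * letter b) * word w) := by
          simp only [word_cons]; group
        rw [e]
        refine (sameSign_word z).transpose.mul (SameSign.mul ?_ (sameSign_word w))
        rw [sameSign_iff]
        revert hab
        cases a <;> cases b <;> decide

theorem apart_edge {e f : Edge} (h : ¬ e.Le f) (h' : ¬ f.Le e) : Apart (edge e) (edge f) := by
  obtain ⟨i, z⟩ := e
  obtain ⟨j, w⟩ := f
  by_cases hij : i = j
  · subst hij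
    obtain ⟨K, hK, e⟩ := apart_word (z := z) (w := w) (by simpa [Edge.Le] using h)
      (by simpa [Edge.Le] using h')
    exact ⟨K, hK, by simp [edge, e, mul_assoc]⟩
  · rw [apart_iff]
    have e : J⁻¹ * (edge (i, z))⁻¹ * edge (j, w) =
        (J⁻¹ * (word z)⁻¹ * J) * ((J⁻¹ * (δ ^ (i : ℕ))⁻¹ * δ ^ (j : ℕ)) * word w) := by
      simp only [edge]; group
    rw [e]
    refine (sameSign_word z).transpose.mul (SameSign.mul ?_ (sameSign_word w))
    rw [sameSign_iff]
    clear h h' e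
    revert i j
    decide

/-! ### Coded transvections -/

/-- A code for a conjugate of `U`, recording the path from the base vertex to its region. -/
inductive Code
  | short (i : Fin 3)
  | long (e : Edge)

open Code

/-- The conjugate of `U` with a given code. -/
def twist : Code → SL2Z
  | short i => δ ^ (i : ℕ) * U * (δ ^ (i : ℕ))⁻¹
  | long e => edge e * W * (edge e)⁻¹

/-- The distance from the base vertex to the region of a coded conjugate of `U`. -/
def depth : Code → ℕ
  | short _ => 0
  | long e => e.2.length + 1

/-- The middle edge of the path from the base vertex to its image. -/
def outE : Code → Edge
  | short i => (i, [])
  | long e => (e.1, e.2 ++ [true])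

/-- The middle edge of the path from the base vertex to its preimage. -/
def inE : Code → Edge
  | short i => (i + 2, [])
  | long e => (e.1, e.2 ++ [false])

theorem length_outE (c : Code) : (outE c).2.length = depth c := by cases c <;> simp [outE, depth]
theorem length_inE (c : Code) : (inE c).2.length = depth c := by cases c <;> simp [inE, depth]

theorem twist_mul_inE (c : Code) : SignEq (twist c * edge (inE c) * J) (edge (outE c)) := by
  cases c with
  | short i =>
    simp only [twist, inE, outE, edge, word_nil, SignEq]
    revert i; decide
  | long e =>
    left
    have : W * U * J = V⁻¹ := by decide
    simp [twist, inE, outE, edge, letter, ← this, mul_assoc]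

theorem twist_inv_mul_outE (c : Code) :
    SignEq ((twist c)⁻¹ * edge (outE c) * J) (edge (inE c)) := by
  have h := ((twist_mul_inE c).mul_left (twist c)⁻¹).mul_right J
  refine h.symm.trans (Or.inr ?_)
  have : J * J = -1 := by decide
  simp [mul_assoc, this]

theorem exists_twist_δ (c : Code) :
    ∃ c', twist c' = δ * twist c * δ⁻¹ ∧ depth c' = depth c := by
  have key : ∀ i : Fin 3, SignEq (δ * δ ^ (i : ℕ)) (δ ^ ((i + 1 : Fin 3) : ℕ)) := by
    unfold SignEq; decide
  cases c with
  | short i =>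
    refine ⟨short (i + 1), ?_, rfl⟩
    simp only [twist]
    rw [← (key i).conj_eq]; group
  | long e =>
    refine ⟨long (e.1 + 1, e.2), ?_, rfl⟩
    have := ((key e.1).mul_right (word e.2)).conj_eq W
    simp only [twist, edge]
    rw [← this]; group

theorem exists_twist_δ_pow (n : ℕ) (c : Code) :
    ∃ c', twist c' = δ ^ n * twist c * (δ ^ n)⁻¹ ∧ depth c' = depth c := by
  induction n with
  | zero => exact ⟨c, by simp, rfl⟩
  | succ n ih =>
    obtain ⟨c', h, hd⟩ := ih
    obtain ⟨c'', h', hd'⟩ := exists_twist_δ c'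
    exact ⟨c'', by rw [h', h, pow_succ']; group, hd'.trans hd⟩

theorem exists_twist_J_zero (u : List Bool) :
    ∃ c', twist c' = J * twist (long (0, u)) * J⁻¹ ∧ depth c' = u.length := by
  cases u with
  | nil => exact ⟨short 2, by decide, rfl⟩
  | cons b u =>
    cases b
    · refine ⟨long (1, u), ?_, rfl⟩
      have : J * U = δ := by decide
      simp [twist, edge, letter, ← this, mul_assoc]
    · refine ⟨long (2, u), ?_, rfl⟩
      have : J * V⁻¹ = δ ^ 2 := by decide
      simp only [twist, edge, word_cons, letter, Fin.coe_ofNat_eq_mod, ← this]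
      group

theorem exists_twist_J (c : Code) :
    ∃ c', twist c' = J * twist c * J⁻¹ ∧ depth c' ≤ depth c + 1 := by
  cases c with
  | short i =>
    have h0 : twist (short 1) = J * twist (short 0) * J⁻¹ := by decide
    have h1 : twist (short 0) = J * twist (short 1) * J⁻¹ := by decide
    have h2 : twist (long (0, [])) = J * twist (short 2) * J⁻¹ := by decide
    fin_cases i
    · exact ⟨_, h0, by simp [depth]⟩
    · exact ⟨_, h1, by simp [depth]⟩
    · exact ⟨_, h2, by simp [depth]⟩
  | long e =>
    obtain ⟨i, u⟩ := e
    have h1 : SignEq (J * δ) U := by unfold SignEq; decide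
    have h2 : SignEq (J * δ ^ 2) V⁻¹ := by unfold SignEq; decide
    fin_cases i
    · obtain ⟨c', h, hd⟩ := exists_twist_J_zero u
      exact ⟨c', h, by rw [hd]; simp only [depth]; omega⟩
    · refine ⟨long (0, false :: u), ?_, by simp [depth]⟩
      have := (h1.mul_right (word u)).conj_eq W
      simpa [twist, edge, letter, mul_assoc] using this.symm
    · refine ⟨long (0, true :: u), ?_, by simp [depth]⟩
      have := (h2.mul_right (word u)).conj_eq W
      simpa [twist, edge, letter, mul_assoc] using this.symm

theorem exists_twist_word (p : List Bool) (c : Code) :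
    ∃ c', twist c' = word p * twist c * (word p)⁻¹ ∧ depth c' ≤ p.length + depth c := by
  induction p with
  | nil => exact ⟨c, by simp, by simp⟩
  | cons b p ih =>
    obtain ⟨c₁, h₁, d₁⟩ := ih
    have hb : ∃ n : ℕ, SignEq (letter b) (J * δ ^ n) := by
      unfold SignEq
      cases b
      · exact ⟨1, by decide⟩
      · exact ⟨2, by decide⟩
    obtain ⟨n, hn⟩ := hb
    obtain ⟨c₂, h₂, d₂⟩ := exists_twist_δ_pow n c₁
    obtain ⟨c₃, h₃, d₃⟩ := exists_twist_J c₂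
    refine ⟨c₃, ?_, by simp only [List.length_cons]; omega⟩
    calc twist c₃ = (J * δ ^ n) * twist c₁ * (J * δ ^ n)⁻¹ := by rw [h₃, h₂]; group
      _ = letter b * twist c₁ * (letter b)⁻¹ := (hn.conj_eq _).symm
      _ = _ := by rw [h₁, word_cons]; group

theorem exists_twist_edge (e : Edge) (c : Code) :
    ∃ c', twist c' = edge e * twist c * (edge e)⁻¹ ∧ depth c' ≤ e.2.length + depth c := by
  obtain ⟨c₁, h₁, d₁⟩ := exists_twist_word e.2 c
  obtain ⟨c₂, h₂, d₂⟩ := exists_twist_δ_pow e.1 c₁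
  exact ⟨c₂, by rw [h₂, h₁, edge]; group, by omega⟩

/-- Every conjugate of `U` has a code. -/
theorem exists_twist_eq_of_isConj {A : SL2Z} (h : IsConj U A) : ∃ c, twist c = A := by
  obtain ⟨q, hq⟩ := isConj_iff.mp h
  have hq' : q ∈ Subgroup.closure {ModularGroup.S, ModularGroup.T} := by
    rw [SpecialLinearGroup.SL2Z_generators]; trivial
  suffices H : ∀ c, (∃ c', twist c' = q * twist c * q⁻¹) ∧ ∃ c', twist c' = q⁻¹ * twist c * q by
    obtain ⟨c', h'⟩ := (H (short 0)).1
    exact ⟨c', by rw [h', ← hq]; simp [twist]⟩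
  clear hq h
  have hJ : ∀ c, ∃ c', twist c' = J * twist c * J⁻¹ := fun c =>
    (exists_twist_J c).imp fun _ h => h.1
  have hU : ∀ c, ∃ c', twist c' = U * twist c * U⁻¹ := fun c =>
    (exists_twist_word [false] c).imp fun _ h => by simpa [letter] using h.1
  have hU' : ∀ c, ∃ c', twist c' = U⁻¹ * twist c * U := fun c => by
    obtain ⟨c₁, h₁⟩ := hJ c
    obtain ⟨c₂, h₂, -⟩ := exists_twist_δ_pow 5 c₁
    have : δ ^ 5 * J = U⁻¹ := by decide
    refine ⟨c₂, ?_⟩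
    rw [h₂, h₁, ← inv_inv U, ← this]; group
  induction hq' using Subgroup.closure_induction with
  | mem x hx =>
    intro c
    rcases hx with rfl | rfl
    · have e : ModularGroup.S = J := by decide
      have e' : SignEq J⁻¹ J := by unfold SignEq; decide
      rw [e]
      refine ⟨hJ c, ?_⟩
      have := e'.conj_eq (twist c)
      rw [inv_inv] at this
      rw [this]
      exact hJ c
    · have e : ModularGroup.T = U := by decide
      rw [e]
      exact ⟨hU c, hU' c⟩
  | one => exact fun c => ⟨⟨c, by simp⟩, ⟨c, by simp⟩⟩
  | mul x y _ _ hx hy =>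
    intro c
    constructor
    · obtain ⟨c₁, h₁⟩ := (hy c).1
      obtain ⟨c₂, h₂⟩ := (hx c₁).1
      exact ⟨c₂, by rw [h₂, h₁]; group⟩
    · obtain ⟨c₁, h₁⟩ := (hx c).2
      obtain ⟨c₂, h₂⟩ := (hy c₁).2
      exact ⟨c₂, by rw [h₂, h₁]; group⟩
  | inv x _ hx =>
    intro c
    exact ⟨by simpa using (hx c).2, by simpa using (hx c).1⟩

/-! ### Reduction of depth -/

theorem exists_shorter {x : SL2Z} {e f g : Edge} (hl : f.2.length ≤ e.2.length)
    (hx : SignEq (x * edge e) (edge f * J)) (hg : e.Le g) :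
    ∃ c', twist c' = x * twist (long g) * x⁻¹ ∧ depth c' < depth (long g) := by
  obtain ⟨i, p⟩ := e
  obtain ⟨j, w⟩ := g
  obtain ⟨hi, u, hu⟩ := hg
  simp only at hi hu hl
  subst hi hu
  obtain ⟨c₁, h₁, d₁⟩ := exists_twist_J_zero u
  obtain ⟨c₂, h₂, d₂⟩ := exists_twist_edge f c₁
  refine ⟨c₂, ?_, ?_⟩
  · calc twist c₂ = (edge f * J) * twist (long (0, u)) * (edge f * J)⁻¹ := by rw [h₂, h₁]; group
      _ = (x * edge (i, p)) * twist (long (0, u)) * (x * edge (i, p))⁻¹ := (hx.conj_eq _).symm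
      _ = _ := by simp only [twist, edge, word_append, Fin.val_zero, pow_zero]; group
  · have : depth (long (i, p ++ u)) = p.length + u.length + 1 := by simp [depth]
    omega

theorem SignEq.move_J {a b : SL2Z} (h : SignEq (a * J) b) : SignEq a (b * J) := by
  have hJ : J * J = -1 := by decide
  refine SignEq.trans (Or.inr ?_) (h.mul_right J)
  simp [mul_assoc, hJ]

theorem twist_mul_inE_eq (c : Code) : SignEq (twist c * edge (inE c)) (edge (outE c) * J) :=
  (twist_mul_inE c).move_J

theorem twist_inv_mul_outE_eq (c : Code) :
    SignEq ((twist c)⁻¹ * edge (outE c)) (edge (inE c) * J) :=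
  (twist_inv_mul_outE c).move_J

/-- No Hurwitz move on the pair `(g, h)` visibly decreases the depth, and the product of the pair
is not a rotation about the base vertex. -/
structure Reduced (g h : Code) : Prop where
  not_le_right : ∀ e, h = long e → ¬ (inE g).Le e
  not_le_left : ∀ e, g = long e → ¬ (outE h).Le e
  not_rotation : ∀ i, ¬ (g = short (i + 1) ∧ h = short i)

theorem Reduced.not_inE_le_outE {g h : Code} (H : Reduced g h) : ¬ (inE g).Le (outE h) := by
  rintro ⟨h1, h2⟩
  cases g with
  | short i =>
    cases h with
    | short j =>
      refine H.not_rotation j ⟨?_, rfl⟩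
      simp only [inE, outE] at h1
      rw [← h1]; congr 1; clear h1 h2 H; revert i; decide
    | long f => exact H.not_le_right f rfl ⟨h1, List.nil_prefix⟩
  | long e =>
    cases h with
    | short j => simp [inE, outE] at h2
    | long f =>
      rcases List.prefix_concat_iff.mp h2 with h2 | h2
      · simp [inE] at h2
      · exact H.not_le_right f rfl ⟨h1, h2⟩

theorem Reduced.not_outE_le_inE {g h : Code} (H : Reduced g h) : ¬ (outE h).Le (inE g) := by
  rintro ⟨h1, h2⟩
  cases g with
  | short i =>
    cases h with
    | short j => exact H.not_inE_le_outE ⟨h1.symm, List.nil_prefix⟩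
    | long f => simp [inE, outE] at h2
  | long e =>
    rcases List.prefix_concat_iff.mp h2 with h2 | h2
    · cases h <;> simp [outE] at h2
    · exact H.not_le_left e rfl ⟨h1, h2⟩

theorem Reduced.apart {g h : Code} (H : Reduced g h) : Apart (edge (inE g)) (edge (outE h)) :=
  apart_edge H.not_inE_le_outE H.not_outE_le_inE

theorem not_le_concat {e f : Edge} {b : Bool} (hl : f.2.length ≤ e.2.length) (hne : f ≠ e)
    (h : ¬ Edge.Le (f.1, f.2 ++ [b]) e) : ¬ e.Le (f.1, f.2 ++ [b]) := by
  rintro ⟨h1, h2⟩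
  rcases List.prefix_concat_iff.mp h2 with h2 | h2
  · exact h ⟨h1.symm, h2 ▸ List.prefix_rfl⟩
  · exact hne (Prod.ext h1.symm (h2.eq_of_length_le hl).symm)

theorem not_le_short {e : Edge} {i : Fin 3} (h : ¬ Edge.Le (i, []) e) : ¬ e.Le (i, []) := by
  rintro ⟨h1, -⟩
  exact h ⟨h1.symm, List.nil_prefix⟩

theorem Reduced.eq_or_apart_outE {e : Edge} {h : Code} (H : Reduced (long e) h)
    (hd : depth h ≤ depth (long e)) : h = long e ∨ Apart (edge e) (edge (outE h)) := by
  have h1 := H.not_le_left e rfl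
  cases h with
  | short i => exact Or.inr (apart_edge (not_le_short h1) h1)
  | long f =>
    by_cases hf : f = e
    · exact Or.inl (hf ▸ rfl)
    · exact Or.inr (apart_edge (not_le_concat (Nat.le_of_succ_le_succ hd) hf h1) h1)

theorem Reduced.eq_or_apart_inE {e : Edge} {g : Code} (H : Reduced g (long e))
    (hd : depth g ≤ depth (long e)) : g = long e ∨ Apart (edge e) (edge (inE g)) := by
  have h1 := H.not_le_right e rfl
  cases g with
  | short i => exact Or.inr (apart_edge (not_le_short h1) h1)
  | long f =>
    by_cases hf : f = e
    · exact Or.inl (hf ▸ rfl)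
    · exact Or.inr (apart_edge (not_le_concat (Nat.le_of_succ_le_succ hd) hf h1) h1)

/-! ### Ping-pong -/

/-- The image of the base vertex under `S` lies beyond the edge with matrix `M`. -/
def Beyond (M S : SL2Z) : Prop := ∃ K, SameSign K ∧ ∃ c : ℤ, S = M * K * U * δ ^ c

theorem Beyond.mul_left {g a b S : SL2Z} (h : SignEq (g * b * J) a) (hS : Beyond (b * J) S) :
    Beyond a (g * S) := by
  obtain ⟨K, hK, c, rfl⟩ := hS
  have e : g * (b * J * K * U * δ ^ c) = (g * b * J) * (K * U * δ ^ c) := by group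
  rw [e]
  rcases h with h | h
  · exact ⟨K, hK, c, by rw [h]; group⟩
  · exact ⟨-K, hK.neg, c, by rw [h]; simp [mul_assoc]⟩

theorem Beyond.of_apart {a b S : SL2Z} (h : Apart b a) (hS : Beyond a S) : Beyond (b * J) S := by
  obtain ⟨K, hK, c, rfl⟩ := hS
  obtain ⟨L, hL, rfl⟩ := h
  exact ⟨L * K, hL.mul hK, c, by group⟩

theorem beyond_one (e : Edge) : Beyond (edge e * J) 1 := by
  refine ⟨_, (sameSign_word e.2).transpose, -(e.1 + 1 : ℤ), ?_⟩
  have h : edge e * J * (J⁻¹ * (word e.2)⁻¹ * J) = δ ^ ((e.1 : ℕ) : ℤ) * J := by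
    simp only [edge]; group
  have hJ : J * U = δ := by decide
  rw [h, mul_assoc (δ ^ _), hJ]
  group

section PingPong

variable {R : Code → Code → Prop} {g a b : Code → SL2Z}

theorem beyond_prod_cons (hg : ∀ c, SignEq (g c * b c * J) (a c)) (h1 : ∀ c, Beyond (b c * J) 1)
    (hR : ∀ c d, R c d → Apart (b c) (a d)) (c : Code) (t : List Code)
    (h : List.IsChain R (c :: t)) : Beyond (a c) ((c :: t).map g).prod := by
  induction t generalizing c with
  | nil => simpa using Beyond.mul_left (hg c) (h1 c)
  | cons d t ih =>
    rw [List.isChain_cons_cons] at h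
    rw [List.map_cons, List.prod_cons]
    exact Beyond.mul_left (hg c) (Beyond.of_apart (hR c d h.1) (ih d h.2))

theorem exists_beyond_prod (hg : ∀ c, SignEq (g c * b c * J) (a c))
    (h1 : ∀ c, Beyond (b c * J) 1) (hR : ∀ c d, R c d → Apart (b c) (a d)) {M : SL2Z}
    (hM : Beyond (M * J) 1) {r : Code} (t : List Code) (h : List.IsChain R (r :: t))
    (hr : ∀ c ∈ t, R r c → c = r ∨ Apart M (a c)) :
    ∃ (m : ℕ) (S : SL2Z), Beyond (M * J) S ∧ (t.map g).prod = g r ^ m * S := by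
  induction t with
  | nil => exact ⟨0, 1, hM, by simp⟩
  | cons d t ih =>
    rw [List.isChain_cons_cons] at h
    rcases hr d List.mem_cons_self h.1 with rfl | hd
    · obtain ⟨m, S, hS, e⟩ := ih h.2 fun c hc => hr c (List.mem_cons_of_mem _ hc)
      exact ⟨m + 1, S, hS, by rw [List.map_cons, List.prod_cons, e, pow_succ']; group⟩
    · exact ⟨0, _, Beyond.of_apart hd (beyond_prod_cons hg h1 hR d t h.2), by simp⟩

end PingPong

theorem W_pow_mul_J (N : ℕ) : (W ^ N * J) 0 0 = N ∧ (W ^ N * J) 0 1 = N - 1 ∧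
    (W ^ N * J) 1 0 = N + 1 ∧ (W ^ N * J) 1 1 = N := by
  induction N with
  | zero => decide
  | succ N ih =>
    obtain ⟨h1, h2, h3, h4⟩ := ih
    have w00 : W 0 0 = 0 := by decide
    have w01 : W 0 1 = 1 := by decide
    have w10 : W 1 0 = -1 := by decide
    have w11 : W 1 1 = 2 := by decide
    rw [pow_succ', mul_assoc]
    simp only [mul_entry W, h1, h2, h3, h4, w00, w01, w10, w11]
    push_cast
    refine ⟨?_, ?_, ?_, ?_⟩ <;> ring

theorem U_pow_entries (n : ℕ) : (U ^ n) 0 0 = 1 ∧ (U ^ n) 0 1 = n ∧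
    (U ^ n) 1 0 = 0 ∧ (U ^ n) 1 1 = 1 := by
  induction n with
  | zero => decide
  | succ n ih =>
    obtain ⟨h1, h2, h3, h4⟩ := ih
    have w00 : U 0 0 = 1 := by decide
    have w01 : U 0 1 = 1 := by decide
    have w10 : U 1 0 = 0 := by decide
    have w11 : U 1 1 = 1 := by decide
    rw [pow_succ']
    simp only [mul_entry U, h1, h2, h3, h4, w00, w01, w10, w11]
    push_cast
    exact ⟨trivial, by ring, trivial, by ring⟩

theorem δ_zpow_signEq (c : ℤ) : ∃ i : Fin 3, (i : ℤ) = c % 3 ∧ SignEq (δ ^ c) (δ ^ (i : ℕ)) := by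
  have h0 := Int.emod_nonneg c (by norm_num : (3 : ℤ) ≠ 0)
  have h1 := Int.emod_lt_of_pos c (by norm_num : (0 : ℤ) < 3)
  refine ⟨⟨(c % 3).toNat, by omega⟩, by simp [h0], ?_⟩
  have h3 : δ ^ (3 : ℤ) = -1 := by decide
  have e : δ ^ c = (-1) ^ (c / 3) * δ ^ (c % 3).toNat := by
    rw [← h3, ← zpow_mul, ← zpow_natCast, ← zpow_add, Int.toNat_of_nonneg h0]
    congr 1
    omega
  rw [e]
  rcases Int.even_or_odd (c / 3) with h | h
  · left; rw [h.neg_zpow, one_zpow, one_mul]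
  · right; rw [h.neg_zpow, one_zpow, neg_one_mul]

set_option linter.unusedSimpArgs false in
theorem eq_U_pow {n : ℕ} {K : SL2Z} (hK : SameSign K) {c b : ℤ}
    (h : δ ^ c * K * U * δ ^ b = U ^ n) : 3 ∣ c ∧ 3 ∣ b ∧ K 1 0 = 0 := by
  obtain ⟨i, hi, hi'⟩ := δ_zpow_signEq c
  obtain ⟨j, hj, hj'⟩ := δ_zpow_signEq b
  obtain ⟨L, hL, hKL, e⟩ : ∃ L, SameSign L ∧ (K 1 0 = L 1 0 ∨ K 1 0 = -L 1 0) ∧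
      δ ^ (i : ℕ) * L * U * δ ^ (j : ℕ) = U ^ n := by
    have n10 : (-K) 1 0 = -K 1 0 := rfl
    rcases hi' with hi' | hi' <;> rcases hj' with hj' | hj' <;> rw [hi', hj'] at h
    · exact ⟨K, hK, Or.inl rfl, h⟩
    · exact ⟨-K, hK.neg, Or.inr (by rw [n10]; ring), by simpa using h⟩
    · exact ⟨-K, hK.neg, Or.inr (by rw [n10]; ring), by simpa using h⟩
    · exact ⟨K, hK, Or.inl rfl, by simpa using h⟩
  have key : i = 0 ∧ j = 0 ∧ L 1 0 = 0 := by
    obtain ⟨u1, u2, u3, u4⟩ := U_pow_entries n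
    rw [← e] at u1 u2 u3 u4
    rw [sameSign_iff] at hL
    have U00 : U 0 0 = 1 := by decide
    have U01 : U 0 1 = 1 := by decide
    have U10 : U 1 0 = 0 := by decide
    have U11 : U 1 1 = 1 := by decide
    have d00 : δ 0 0 = 0 := by decide
    have d01 : δ 0 1 = -1 := by decide
    have d10 : δ 1 0 = 1 := by decide
    have d11 : δ 1 1 = 1 := by decide
    clear hi hj hi' hj' hKL e h
    fin_cases i <;> fin_cases j <;>
      simp only [Fin.zero_eta, Fin.mk_one, Fin.reduceFinMk, Fin.val_zero, Fin.val_one, Fin.val_two,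
        pow_zero, pow_one, pow_two, one_mul, mul_one, mul_entry, U00, U01, U10, U11,
        d00, d01, d10, d11] at u1 u2 u3 u4 <;> simp <;> omega
  obtain ⟨rfl, rfl, hL0⟩ := key
  simp only [Fin.val_zero, Nat.cast_zero] at hi hj
  omega

theorem V_mul_U_pow (k : ℕ) : (V * U) ^ k = δ ^ (-k : ℤ) := by
  have h : V * U = δ⁻¹ := by decide
  rw [h, inv_pow, zpow_neg, zpow_natCast]

theorem ne_U_pow_of_beyond {n k N : ℕ} {e : Edge} {S S' : SL2Z} (hN : N ≠ 0)
    (hS : Beyond (edge e * J) S) (hS' : Beyond (edge e * J) S') :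
    S'⁻¹ * twist (long e) ^ N * S * (V * U) ^ k ≠ U ^ n := by
  intro h
  obtain ⟨K, hK, c, rfl⟩ := hS
  obtain ⟨K', hK', c', rfl⟩ := hS'
  have hU : U = J⁻¹ * δ := by decide
  have hJ : J⁻¹ = -J := by decide
  have e₁ : (edge e * J * K' * U * δ ^ c')⁻¹ =
      δ ^ (-c' - 1) * (J⁻¹ * K'⁻¹ * J) * (edge e)⁻¹ := by
    have : (edge e * J * K' * U * δ ^ c')⁻¹ = δ ^ (-c') * U⁻¹ * K'⁻¹ * J⁻¹ * (edge e)⁻¹ := by group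
    have hJ' : (J⁻¹)⁻¹ = -J⁻¹ := by decide
    rw [this, hU, mul_inv_rev, hJ']
    nth_rewrite 2 [hJ]
    rw [zpow_sub_one]
    simp [mul_assoc]
  rw [e₁, twist, conj_pow, V_mul_U_pow] at h
  have hW := W_pow_mul_J N
  have hWs : SameSign (W ^ N * J) := by
    rw [sameSign_iff, hW.1, hW.2.1, hW.2.2.1, hW.2.2.2]
    omega
  have h' : δ ^ (-c' - 1) * (J⁻¹ * K'⁻¹ * J * (W ^ N * J) * K) * U * δ ^ (c + -k) = U ^ n := by
    rw [← h]; group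
  refine SameSign.mul_lowerLeft_ne_zero (hK'.transpose.mul hWs) hK (Or.inl ?_)
    (eq_U_pow ((hK'.transpose.mul hWs).mul hK) h').2.2
  refine SameSign.mul_lowerLeft_ne_zero hK'.transpose hWs (Or.inr ?_)
  rw [hW.2.2.1]
  omega

theorem not_long_mem {n k : ℕ} {l : List Code} (hl : List.IsChain Reduced l)
    (h : (l.map twist).prod * (V * U) ^ k = U ^ n) (e : Edge) : long e ∉ l := by
  intro he
  obtain ⟨r, hr, hmax⟩ := Set.exists_max_image {c | c ∈ l} depth l.finite_toSet ⟨_, he⟩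
  obtain ⟨f, rfl⟩ : ∃ f, r = long f := by
    cases r with
    | short i => exact absurd (hmax _ he) (by simp [depth])
    | long f => exact ⟨f, rfl⟩
  obtain ⟨s, t, rfl⟩ := List.append_of_mem hr
  rw [List.isChain_split] at hl
  obtain ⟨m, S, hS, eS⟩ := exists_beyond_prod (g := twist) (a := edge ∘ outE) (b := edge ∘ inE)
    twist_mul_inE (fun c => beyond_one _) (fun c d => Reduced.apart) (beyond_one f) t hl.2
    fun c hc hR => hR.eq_or_apart_outE (hmax c (by simp [hc]))
  have hl' : List.IsChain (fun c d => Reduced d c) (long f :: s.reverse) := by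
    have := List.isChain_reverse.mpr hl.1
    simpa using this
  obtain ⟨m', S', hS', eS'⟩ := exists_beyond_prod (g := fun c => (twist c)⁻¹) (a := edge ∘ inE)
    (b := edge ∘ outE) twist_inv_mul_outE (fun c => beyond_one _)
    (fun c d (hR : Reduced d c) => hR.apart.symm) (beyond_one f) s.reverse hl'
    fun c hc hR => Reduced.eq_or_apart_inE hR (hmax c (by simp_all))
  have es : (s.map twist).prod = S'⁻¹ * twist (long f) ^ m' := by
    have : (s.map twist).prod = ((s.reverse.map fun c => (twist c)⁻¹).prod)⁻¹ := by
      rw [List.prod_inv_reverse]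
      simp [List.map_reverse, Function.comp_def]
    rw [this, eS']
    group
  refine ne_U_pow_of_beyond (n := n) (k := k) (N := m' + 1 + m) (by omega) hS hS' ?_
  rw [← h, List.map_append, List.prod_append, List.map_cons, List.prod_cons, eS, es]
  rw [pow_add, pow_add]
  group

theorem exists_prod_short (i : Fin 3) (t : List (Fin 3))
    (h : List.IsChain (fun i j => i ≠ j + 1) (i :: t)) :
    ∃ K, SameSign K ∧ ∃ c : ℤ, ((i :: t).map fun j => twist (short j)).prod =
      δ ^ (i : ℕ) * K * U * δ ^ c ∧ (K 1 0 ≠ 0 ∨ t = List.replicate t.length i) := by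
  induction t generalizing i with
  | nil => exact ⟨1, sameSign_one, -i, by simp [twist], Or.inr rfl⟩
  | cons j t ih =>
    rw [List.isChain_cons_cons] at h
    obtain ⟨K, hK, c, e, hc⟩ := ih j h.2
    rw [List.map_cons, List.prod_cons, e]
    by_cases hij : j = i
    · subst hij
      refine ⟨U * K, sameSign_U.mul hK, c, by simp [twist, mul_assoc], ?_⟩
      rcases hc with hc | hc
      · exact Or.inl (sameSign_U.mul_lowerLeft_ne_zero hK (Or.inr hc))
      · refine Or.inr ?_
        rw [List.length_cons, List.replicate_succ, ← hc]
    · have key : ∀ i j : Fin 3, j ≠ i → i ≠ j + 1 →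
          SignEq (δ ^ (i : ℕ) * U * (δ ^ (i : ℕ))⁻¹ * δ ^ (j : ℕ)) (δ ^ (i : ℕ) * V⁻¹) := by
        unfold SignEq; decide
      have hVK : (V⁻¹ * K) 1 0 ≠ 0 :=
        sameSign_V_inv.mul_lowerLeft_ne_zero hK (Or.inl (by decide))
      rcases key i j hij h.1 with k | k
      · refine ⟨V⁻¹ * K, sameSign_V_inv.mul hK, c, ?_, Or.inl hVK⟩
        simp only [twist, ← mul_assoc, k]
      · refine ⟨-(V⁻¹ * K), (sameSign_V_inv.mul hK).neg, c, ?_, Or.inl (neg_ne_zero.mpr hVK)⟩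
        simp only [twist, ← mul_assoc, k]
        simp [mul_assoc]

theorem eq_replicate_of_prod_eq {n k : ℕ} {l : List Code} (hl : List.IsChain Reduced l)
    (h : (l.map twist).prod * (V * U) ^ k = U ^ n) : l = List.replicate n (short 0) ∧ 6 ∣ k := by
  have h10 : ∀ m : ℕ, (U ^ m) 0 1 = m ∧ (U ^ m) 0 0 = 1 := fun m =>
    ⟨(U_pow_entries m).2.1, (U_pow_entries m).1⟩
  have h3 : δ ^ (3 : ℤ) = -1 := by decide
  have three : ∀ b : ℤ, 3 ∣ b → ∀ m : ℕ, U ^ m * δ ^ b = U ^ n → m = n ∧ 6 ∣ b := by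
    rintro _ ⟨b, rfl⟩ m e
    rw [zpow_mul, h3] at e
    rcases Int.even_or_odd b with hb | hb
    · rw [hb.neg_zpow, one_zpow, mul_one] at e
      have := (h10 m).1
      rw [e, (h10 n).1] at this
      obtain ⟨b, rfl⟩ := hb
      omega
    · rw [hb.neg_zpow, one_zpow] at e
      have := (h10 n).2
      rw [← e, mul_neg, mul_one, Matrix.SpecialLinearGroup.coe_neg, Matrix.neg_apply,
        (h10 m).2] at this
      omega
  obtain ⟨t, rfl⟩ : ∃ t : List (Fin 3), l = t.map short := by
    have hs : ∀ c ∈ l, ∃ i, short i = c := by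
      intro c hc
      cases c with
      | short i => exact ⟨i, rfl⟩
      | long e => exact absurd hc (not_long_mem hl h e)
    have : l ∈ Set.range (List.map short) := by
      rw [Set.range_list_map]; exact hs
    obtain ⟨t, ht⟩ := this
    exact ⟨t, ht.symm⟩
  have hl' : List.IsChain (fun i j : Fin 3 => i ≠ j + 1) t := by
    rw [List.isChain_map] at hl
    exact hl.imp fun i j hR hij => hR.not_rotation j ⟨hij ▸ rfl, rfl⟩
  rw [V_mul_U_pow, List.map_map] at h
  cases t with
  | nil =>
    rw [List.map_nil, List.prod_nil, one_mul] at h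
    have h3k := (eq_U_pow (n := n + 1) (c := -k) (b := 0) sameSign_one
      (by rw [h, pow_succ, zpow_zero, mul_one, mul_one])).1
    obtain ⟨hm, h6k⟩ := three _ h3k 0 (by rw [h, pow_zero, one_mul])
    exact ⟨by rw [← hm]; rfl, by omega⟩
  | cons i t =>
    obtain ⟨K, hK, c, e, hc⟩ := exists_prod_short i t hl'
    change ((i :: t).map fun j => twist (short j)).prod * _ = _ at h
    have h' := h
    rw [e, mul_assoc, ← zpow_add, ← zpow_natCast δ] at h'
    obtain ⟨hi, -, hK0⟩ := eq_U_pow hK h'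
    have hi0 : i = 0 := by omega
    subst hi0
    have ht := hc.resolve_left (not_not_intro hK0)
    have hU : twist (short 0) = U := by decide
    generalize t.length = m at ht
    subst ht
    rw [← List.replicate_succ, List.map_replicate, hU, List.prod_replicate] at h
    have hUs : SameSign (U ^ m) := by
      obtain ⟨h1, h2, h3, h4⟩ := U_pow_entries m
      rw [sameSign_iff, h1, h2, h3, h4]
      omega
    have h3k := (eq_U_pow (c := 0) (b := -k) hUs (by rw [← h, pow_succ, zpow_zero, one_mul])).2.1
    obtain ⟨hm, h6k⟩ := three _ h3k _ h
    refine ⟨?_, by omega⟩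
    rw [← hm, ← List.replicate_succ, List.map_replicate]

/-! ### Hurwitz moves -/

section Hurwitz

variable {G : Type*} [Group G]

theorem _root_.HurwitzEquiv.refl (L : List G) : HurwitzEquiv L L := Relation.ReflTransGen.refl

theorem _root_.HurwitzEquiv.trans {L L' L'' : List G} (h : HurwitzEquiv L L')
    (h' : HurwitzEquiv L' L'') : HurwitzEquiv L L'' := Relation.ReflTransGen.trans h h'

theorem hurwitzMove_append {L L' : List G} (p t : List G) (h : HurwitzMove L L') :
    HurwitzMove (p ++ L ++ t) (p ++ L' ++ t) := by
  obtain ⟨q, a, b, s, rfl, h⟩ := h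
  refine ⟨p ++ q, a, b, s ++ t, by simp, ?_⟩
  rcases h with rfl | rfl
  · left; simp
  · right; simp

theorem hurwitzEquiv_append {L L' : List G} (p t : List G) (h : HurwitzEquiv L L') :
    HurwitzEquiv (p ++ L ++ t) (p ++ L' ++ t) :=
  Relation.ReflTransGen.lift (fun L => p ++ L ++ t) (fun _ _ => hurwitzMove_append p t) _ _ h

theorem hurwitzEquiv_right (a b : G) (p t : List G) :
    HurwitzEquiv (p ++ a :: b :: t) (p ++ (a * b * a⁻¹) :: a :: t) :=
  .single ⟨p, a, b, t, rfl, Or.inr rfl⟩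

theorem hurwitzEquiv_left (a b : G) (p t : List G) :
    HurwitzEquiv (p ++ a :: b :: t) (p ++ b :: (b⁻¹ * a * b) :: t) :=
  .single ⟨p, a, b, t, rfl, Or.inl rfl⟩

theorem _root_.HurwitzEquiv.length_eq {L L' : List G} (h : HurwitzEquiv L L') :
    L.length = L'.length := by
  induction h with
  | refl => rfl
  | tail _ h ih =>
    obtain ⟨p, a, b, t, rfl, rfl | rfl⟩ := h <;> simpa using ih

theorem _root_.HurwitzEquiv.prod_eq {L L' : List G} (h : HurwitzEquiv L L') : L.prod = L'.prod := by
  induction h with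
  | refl => rfl
  | tail _ h ih =>
    obtain ⟨p, a, b, t, rfl, rfl | rfl⟩ := h <;> rw [ih] <;> simp [mul_assoc]

theorem hurwitzEquiv_cons_append (a : G) (m : List G) :
    HurwitzEquiv (a :: m) (m.map (fun x => a * x * a⁻¹) ++ [a]) := by
  induction m with
  | nil => exact .refl _
  | cons b m ih =>
    refine (hurwitzEquiv_right a b [] m).trans ?_
    simpa using hurwitzEquiv_append [a * b * a⁻¹] [] ih

theorem hurwitzEquiv_append_comm (l m : List G) :
    HurwitzEquiv (l ++ m) (m.map (fun x => l.prod * x * l.prod⁻¹) ++ l) := by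
  induction l generalizing m with
  | nil => simpa using HurwitzEquiv.refl m
  | cons a l ih =>
    have h₁ := hurwitzEquiv_append [a] [] (ih m)
    have h₂ := hurwitzEquiv_append [] l
      (hurwitzEquiv_cons_append a (m.map fun x => l.prod * x * l.prod⁻¹))
    simp only [List.nil_append, List.append_nil, List.map_map,
      List.append_assoc, List.cons_append, Function.comp_def] at h₁ h₂
    refine (h₁.trans h₂).trans ?_
    simp only [List.prod_cons, mul_inv_rev, mul_assoc]
    exact .refl _

end Hurwitz

/-- The factorization attached to a list of codes and a number of trailing pairs `(V, U)`. -/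
def factors (l : List Code) (k : ℕ) : List SL2Z :=
  l.map twist ++ (List.replicate k [V, U]).flatten

theorem prod_factors (l : List Code) (k : ℕ) :
    (factors l k).prod = (l.map twist).prod * (V * U) ^ k := by
  simp [factors, List.prod_flatten]

theorem length_factors (l : List Code) (k : ℕ) : (factors l k).length = l.length + 2 * k := by
  simp [factors, mul_comm]

/-- The total depth of a list of codes, plus its length. -/
def weight (l : List Code) : ℕ := l.length + (l.map depth).sum

theorem hurwitzEquiv_rotation (i : Fin 3) :
    HurwitzEquiv [twist (short (i + 1)), twist (short i)] [V, U] := by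
  fin_cases i
  · have h : [twist (short (0 + 1)), twist (short 0)] = [V, U] := by decide
    exact h ▸ .refl _
  · have h : [V, U] = [twist (short 1),
        (twist (short 1))⁻¹ * twist (short 2) * twist (short 1)] := by decide
    exact h ▸ hurwitzEquiv_left (twist (short 2)) (twist (short 1)) [] []
  · have h : [V, U] = [twist (short 0) * twist (short 2) * (twist (short 0))⁻¹,
        twist (short 0)] := by decide
    exact h ▸ hurwitzEquiv_right (twist (short 0)) (twist (short 2)) [] []

theorem exists_map_twist_conj (l : List Code) : ∃ l' : List Code,
    l'.map twist = l.map (fun c => V * U * twist c * (V * U)⁻¹) ∧ weight l' = weight l := by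
  have hδ : V * U = δ ^ 5 := by decide
  induction l with
  | nil => exact ⟨[], rfl, rfl⟩
  | cons c l ih =>
    obtain ⟨l', h, hw⟩ := ih
    obtain ⟨c', hc, hd⟩ := exists_twist_δ_pow 5 c
    refine ⟨c' :: l', by rw [List.map_cons, List.map_cons, h, hc, hδ], ?_⟩
    simp only [weight, List.length_cons, List.map_cons, List.sum_cons] at hw ⊢
    omega

theorem exists_lt_weight {p q : List Code} {g h : Code} (k : ℕ) (H : ¬ Reduced g h) :
    ∃ k' l, HurwitzEquiv (factors (p ++ g :: h :: q) k) (factors l k') ∧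
      weight l < weight (p ++ g :: h :: q) := by
  by_cases h₁ : ∀ e, h = long e → ¬ (inE g).Le e
  · by_cases h₂ : ∀ e, g = long e → ¬ (outE h).Le e
    · by_cases h₃ : ∀ i, ¬ (g = short (i + 1) ∧ h = short i)
      · exact absurd ⟨h₁, h₂, h₃⟩ H
      push Not at h₃
      obtain ⟨i, rfl, rfl⟩ := h₃
      obtain ⟨q', hq, hw⟩ := exists_map_twist_conj q
      refine ⟨k + 1, p ++ q', ?_, ?_⟩
      · have e₁ := hurwitzEquiv_append (p.map twist)
          (q.map twist ++ (List.replicate k [V, U]).flatten) (hurwitzEquiv_rotation i)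
        have e₂ := hurwitzEquiv_append (p.map twist) (List.replicate k [V, U]).flatten
          (hurwitzEquiv_append_comm [V, U] (q.map twist))
        simp only [List.map_map, Function.comp_def, List.prod_cons, List.prod_nil, mul_one] at e₂
        rw [← hq] at e₂
        simp only [List.append_assoc, List.cons_append, List.nil_append] at e₁ e₂
        simpa [factors, List.replicate_succ] using e₁.trans e₂
      · simp only [weight, List.length_append, List.length_cons, List.map_append, List.map_cons,
          List.sum_append, List.sum_cons] at hw ⊢
        omega
    · push Not at h₂
      obtain ⟨e, rfl, he⟩ := h₂
      obtain ⟨c, hc, hd⟩ := exists_shorter (by rw [length_outE, length_inE])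
        (twist_inv_mul_outE_eq h) he
      refine ⟨k, p ++ h :: c :: q, ?_, ?_⟩
      · rw [inv_inv] at hc
        simpa [factors, hc] using hurwitzEquiv_left (twist (long e)) (twist h) (p.map twist)
          (q.map twist ++ (List.replicate k [V, U]).flatten)
      · simp only [weight, List.length_append, List.length_cons, List.map_append, List.map_cons,
          List.sum_append, List.sum_cons]
        omega
  · push Not at h₁
    obtain ⟨e, rfl, he⟩ := h₁
    obtain ⟨c, hc, hd⟩ := exists_shorter (by rw [length_outE, length_inE])
      (twist_mul_inE_eq g) he
    refine ⟨k, p ++ c :: g :: q, ?_, ?_⟩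
    · simpa [factors, hc] using hurwitzEquiv_right (twist g) (twist (long e)) (p.map twist)
        (q.map twist ++ (List.replicate k [V, U]).flatten)
    · simp only [weight, List.length_append, List.length_cons, List.map_append, List.map_cons,
        List.sum_append, List.sum_cons]
      omega

theorem exists_hurwitzEquiv_reduced (l : List Code) (k : ℕ) : ∃ k' l',
    HurwitzEquiv (factors l k) (factors l' k') ∧ List.IsChain Reduced l' := by
  induction hw : weight l using Nat.strong_induction_on generalizing l k with
  | _ w ih =>
    by_cases H : List.IsChain Reduced l
    · exact ⟨k, l, .refl _, H⟩
    · rw [List.isChain_iff_forall_rel_of_append_cons_cons] at H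
      push Not at H
      obtain ⟨g, h, p, q, rfl, H⟩ := H
      obtain ⟨k₁, l₁, e₁, h₁⟩ := exists_lt_weight (p := p) (q := q) k H
      obtain ⟨k₂, l₂, e₂, h₂⟩ := ih _ (hw ▸ h₁) l₁ k₁ rfl
      exact ⟨k₂, l₂, e₁.trans e₂, h₂⟩

theorem exists_map_twist_eq {L : List SL2Z} (h : ∀ A ∈ L, IsConj U A) :
    ∃ l : List Code, l.map twist = L := by
  have : L ∈ Set.range (List.map twist) := by
    rw [Set.range_list_map]
    exact fun A hA => exists_twist_eq_of_isConj (h A hA)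
  exact this

end HurwitzSL2

open HurwitzSL2 Code

/-- **Strong normal factorization for type `wIₙ`** : if `Uⁿ = G₁⋯Gᵣ` with each `Gᵢ` a
conjugate of `U` in `SL(2,ℤ)`, then `r = n + 12s` for some `s ≥ 0` and a finite sequence of
Hurwitz moves transforms `(G₁,…,Gᵣ)` into `n` copies of `U` followed by `6s` copies of the
pair `(V, U)`, i.e. into the factorization `Uⁿ(VU)^(6s)`. -/
theorem strong_normal_factorization_wIn (n : ℕ) (L : List SL2Z)
    (hconj : ∀ A ∈ L, IsConj U A)
    (hprod : L.prod = U ^ n) :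
    ∃ s : ℕ, L.length = n + 12 * s ∧
      HurwitzEquiv L (List.replicate n U ++ (List.replicate (6 * s) [V, U]).flatten) := by
  obtain ⟨l, rfl⟩ := exists_map_twist_eq hconj
  obtain ⟨k, l', h, hl⟩ := exists_hurwitzEquiv_reduced l 0
  have e : factors l 0 = l.map twist := by simp [factors]
  rw [e] at h
  rw [h.prod_eq, prod_factors] at hprod
  obtain ⟨rfl, s, rfl⟩ := eq_replicate_of_prod_eq hl hprod
  have hU : twist (short 0) = U := by decide
  refine ⟨s, ?_, ?_⟩
  · rw [h.length_eq, length_factors, List.length_replicate]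
    omega
  · rwa [factors, List.map_replicate, hU] at h
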